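/- Let n ≥ 1 and let p₀, p₁, …, p_{n+1} be points of ℝⁿ × ℝ. There exists a map f(x, t) = (A x + t·b + c, t + d), with A an invertible n × n real matrix, b, c ∈ ℝⁿ and d ∈ ℝ (i.e., an element of the group (𝒜ᶜ_st, 𝒯_t), whose temporal component is a translation of the time-line), such that f(q_j) = p_j for all 0 ≤ j ≤ n+1, where (q₀, …, q_{n+1}) is the standard coordinate system of ℝⁿ × ℝ, if and only if: (i) the n+2 points p₀, …, p_{n+1} are affinely independent in ℝⁿ × ℝ ≅ ℝ^{n+1}; (ii) the points p₀, p₁, …, pₙ all have the same temporal coordinate; and (iii) the temporal coordinate of p_{n+1} equals the temporal coordinate of p₀ plus 1. -/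

import Mathlib

/-- The standard coordinate system `(q₀, q₁, …, qₙ, q_{n+1})` of `ℝⁿ × ℝ`:
`q₀ = (0,0)`, `qᵢ = (eᵢ, 0)` for `1 ≤ i ≤ n`, and `q_{n+1} = (0,1)`. -/
noncomputable def stdCoordSys (n : ℕ) : Fin (n + 2) → EuclideanSpace ℝ (Fin n) × ℝ :=
  fun j =>
    if _ : (j : ℕ) = 0 then (0, 0)
    else if h' : (j : ℕ) ≤ n then
      (EuclideanSpace.single (⟨(j : ℕ) - 1, by omega⟩ : Fin n) 1, 0)
    else (0, 1)

@[simp]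
theorem stdCoordSys_zero (n : ℕ) : stdCoordSys n 0 = (0, 0) := by
  simp [stdCoordSys]

@[simp]
theorem stdCoordSys_succ_castSucc {n : ℕ} (i : Fin n) :
    stdCoordSys n i.castSucc.succ = (EuclideanSpace.single i 1, 0) := by
  simp [stdCoordSys]

@[simp]
theorem stdCoordSys_last (n : ℕ) : stdCoordSys n (Fin.last (n + 1)) = (0, 1) := by
  simp [stdCoordSys]

/-- Affine independence of a family indexed by `Fin (n + 1)`, through the differences with its
first point. -/
theorem affineIndependent_iff_linearIndependent_succ_sub {k V : Type*} [Ring k] [AddCommGroup V]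
    [Module k V] {n : ℕ} (p : Fin (n + 1) → V) :
    AffineIndependent k p ↔ LinearIndependent k fun i : Fin n => p i.succ - p 0 := by
  rw [affineIndependent_iff_linearIndependent_vsub k p 0,
    ← linearIndependent_equiv (finSuccAboveEquiv 0)]
  rfl

/-- Adjoining to vectors of the hyperplane `V × {0}` a vector of last coordinate `1` preserves and
reflects linear independence. -/
theorem linearIndependent_prod_iff_of_snd {k V : Type*} [Ring k] [AddCommGroup V] [Module k V]
    {n : ℕ} (v : Fin (n + 1) → V × k) (h : ∀ i : Fin n, (v i.castSucc).2 = 0)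
    (hlast : (v (Fin.last n)).2 = 1) :
    LinearIndependent k v ↔ LinearIndependent k fun i : Fin n => (v i.castSucc).1 := by
  rw [Fintype.linearIndependent_iff, Fintype.linearIndependent_iff]
  constructor
  · intro hv g hg i
    have key := hv (Fin.snoc g 0) (by
      ext
      · simpa [Fin.sum_univ_castSucc, Prod.fst_sum] using hg
      · simp [Fin.sum_univ_castSucc, Prod.snd_sum, h]) i.castSucc
    simpa using key
  · intro hv g hg
    have hl : g (Fin.last n) = 0 := by
      simpa [Fin.sum_univ_castSucc, Prod.snd_sum, h, hlast] using congrArg Prod.snd hg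
    refine Fin.lastCases hl (hv (fun i => g i.castSucc) ?_)
    simpa [Fin.sum_univ_castSucc, Prod.fst_sum, hl] using congrArg Prod.fst hg

/-- A real square matrix is invertible iff it maps the standard basis to independent vectors. -/
theorem isUnit_iff_linearIndependent_toEuclideanLin_single {n : ℕ}
    (A : Matrix (Fin n) (Fin n) ℝ) :
    IsUnit A ↔ LinearIndependent ℝ fun i : Fin n =>
      Matrix.toEuclideanLin A (EuclideanSpace.single i 1) := by
  have hcol : (fun i : Fin n => Matrix.toEuclideanLin A (EuclideanSpace.single i 1)) =
      (WithLp.linearEquiv 2 ℝ (Fin n → ℝ)).symm.toLinearMap ∘ A.col := by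
    ext i j
    simp [Matrix.toLpLin_apply]
  rw [hcol, LinearMap.linearIndependent_iff _ (LinearEquiv.ker _),
    Matrix.linearIndependent_cols_iff_isUnit]

/-- `(p₀, …, p_{n+1})` is the image of the standard coordinate system of
`ℝⁿ × ℝ` under an element of `(𝒜ᶜ_st, 𝒯_t)` iff the points are affinely independent,
`p₀, …, pₙ` are co-temporal, and the temporal coordinate of `p_{n+1}` equals that of
`p₀` plus `1`. -/
theorem image_stdCoordSys_timeIndependentAffinity_timeTranslation_iff (n : ℕ) (hn : 1 ≤ n)
    (p : Fin (n + 2) → EuclideanSpace ℝ (Fin n) × ℝ) :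
    (∃ (A : Matrix (Fin n) (Fin n) ℝ) (b c : EuclideanSpace ℝ (Fin n)) (d : ℝ),
        IsUnit A ∧
        ∀ j : Fin (n + 2),
          (Matrix.toEuclideanLin A (stdCoordSys n j).1 + (stdCoordSys n j).2 • b + c,
            (stdCoordSys n j).2 + d) = p j)
      ↔ (AffineIndependent ℝ p ∧
         (∀ j : Fin (n + 2), (j : ℕ) ≤ n → (p j).2 = (p 0).2) ∧
         (p (Fin.last (n + 1))).2 = (p 0).2 + 1) := by
  have affine_iff (h : ∀ j : Fin (n + 2), (j : ℕ) ≤ n → (p j).2 = (p 0).2)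
      (hlast : (p (Fin.last (n + 1))).2 = (p 0).2 + 1) :
      AffineIndependent ℝ p ↔
        LinearIndependent ℝ fun i : Fin n => (p i.castSucc.succ).1 - (p 0).1 := by
    rw [affineIndependent_iff_linearIndependent_succ_sub, linearIndependent_prod_iff_of_snd]
    · rfl
    · intro i
      simp only [Prod.snd_sub]
      rw [h i.castSucc.succ (by simp), sub_self]
    · simp [hlast]
  constructor
  · rintro ⟨A, b, c, d, hA, hp⟩
    have h0 : c = (p 0).1 ∧ d = (p 0).2 := by simp [← hp 0]
    have htime : ∀ j : Fin (n + 2), (j : ℕ) ≤ n → (p j).2 = (p 0).2 := by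
      intro j hj
      rw [← hp j, ← hp 0]
      simp only [stdCoordSys, hj]
      split <;> simp
    have hlast : (p (Fin.last (n + 1))).2 = (p 0).2 + 1 := by
      rw [← hp, ← hp 0]
      simp [add_comm]
    refine ⟨(affine_iff htime hlast).2 ?_, htime, hlast⟩
    convert (isUnit_iff_linearIndependent_toEuclideanLin_single A).1 hA using 2 with i
    rw [← hp, ← hp 0]
    simp
  · rintro ⟨hp, htime, hlast⟩
    let A : Matrix (Fin n) (Fin n) ℝ := Matrix.of fun i j => ((p j.castSucc.succ).1 - (p 0).1) i
    have hA (i : Fin n) : Matrix.toEuclideanLin A (EuclideanSpace.single i 1) =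
        (p i.castSucc.succ).1 - (p 0).1 := by
      ext j
      simp [A, Matrix.toLpLin_apply]
    refine ⟨A, (p (Fin.last (n + 1))).1 - (p 0).1, (p 0).1, (p 0).2, ?_, ?_⟩
    · rw [isUnit_iff_linearIndependent_toEuclideanLin_single]
      simpa only [hA] using (affine_iff htime hlast).1 hp
    · refine Fin.cases (by simp) (Fin.lastCases ?_ fun i => ?_)
      · rw [Fin.succ_last, stdCoordSys_last]
        ext1
        · simp
        · simp [hlast, add_comm]
      · rw [stdCoordSys_succ_castSucc]
        ext1
        · simp only [hA, zero_smul, add_zero, sub_add_cancel]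
        · simp [htime i.castSucc.succ (by simp)]
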